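/- arXiv:2002.05078 — 6 statements merged into one kernel-verified Lean document; each statement's English description precedes it below -/
import Mathlib

section
/- Let X be a topological space and let Y be an open dense subset of X such that Y has a base consisting of cozero subsets of X (i.e., for every y ∈ Y there exist cozero sets of X contained in Y forming a neighborhood base at y). Then every almost dense subset of X is dense in X. -/
/-- A subset `A` of a topological space `X` is almost dense if every continuous
real-valued function vanishing on `A` vanishes on all of `X`. -/
def AlmostDense {X : Type*} [TopologicalSpace X] (A : Set X) : Prop :=
  ∀ f : X → ℝ, Continuous f → (∀ a ∈ A, f a = 0) → ∀ x : X, f x = 0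

/-- A cozero set of `X` is a set of the form `{x | f x ≠ 0}` for a continuous `f : X → ℝ`. -/
def IsCozero {X : Type*} [TopologicalSpace X] (C : Set X) : Prop :=
  ∃ f : X → ℝ, Continuous f ∧ C = {x | f x ≠ 0}

theorem almostDense_dense_of_cozero_base {X : Type*} [TopologicalSpace X]
    (Y : Set X) (hYopen : IsOpen Y) (hYdense : Dense Y)
    (hbase : ∀ y ∈ Y, ∀ U ∈ nhds y, ∃ C : Set X, IsCozero C ∧ C ⊆ Y ∧ C ⊆ U ∧ y ∈ C)
    (A : Set X) (hA : AlmostDense A) : Dense A := by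
  rw [dense_iff_inter_open]
  intro U hU hUne
  obtain ⟨y, hyU, hyY⟩ := hYdense.inter_open_nonempty U hU hUne
  obtain ⟨C, ⟨f, hf, rfl⟩, -, hCU, hyC⟩ := hbase y hyY U (hU.mem_nhds hyU)
  by_contra hUA
  refine hyC (hA f hf (fun a ha => ?_) y)
  by_contra hfa
  exact hUA ⟨a, hCU hfa, ha⟩
end

section
/- Let {X_α : α ∈ Λ} be an arbitrary family of topological spaces and for each α ∈ Λ let A_α be a nonempty almost dense subset of X_α. Then the product ∏_{α∈Λ} A_α is almost dense in the product space ∏_{α∈Λ} X_α. -/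
/-- A continuous real function vanishing on a product of almost dense sets vanishes at every point
having all but finitely many coordinates in the factors. -/
theorem AlmostDense.eq_zero_of_forall_notMem_finset {Λ : Type*} {X : Λ → Type*}
    [∀ α, TopologicalSpace (X α)] {A : ∀ α, Set (X α)} (hA : ∀ α, AlmostDense (A α))
    {f : (∀ α, X α) → ℝ} (hf : Continuous f) (h0 : ∀ a ∈ Set.pi Set.univ A, f a = 0)
    (s : Finset Λ) (x : ∀ α, X α) (hx : ∀ α ∉ s, x α ∈ A α) : f x = 0 := by
  classical
  induction s using Finset.induction_on generalizing x with
  | empty => exact h0 x fun α _ => hx α (Finset.notMem_empty α)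
  | insert i s _ ih =>
    have hupdate := hA i (fun t => f (Function.update x i t))
      (hf.comp (continuous_const.update i continuous_id)) (fun t ht => ih _ fun α hα => by
        rcases eq_or_ne α i with rfl | hne
        · simpa using ht
        · simpa [hne] using hx α (by simp [hne, hα])) (x i)
    simpa using hupdate

theorem almostDense_pi {Λ : Type*} (X : Λ → Type*)
    [∀ α, TopologicalSpace (X α)] (A : ∀ α, Set (X α))
    (hne : ∀ α, (A α).Nonempty) (hA : ∀ α, AlmostDense (A α)) :
    AlmostDense (Set.pi Set.univ A) := by
  classical
  intro f hf h0 x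
  choose a ha using hne
  have hlim : Filter.Tendsto (fun s : Finset Λ => s.piecewise x a) Filter.atTop (nhds x) := by
    refine tendsto_pi_nhds.2 fun i => tendsto_const_nhds.congr' ?_
    filter_upwards [Filter.eventually_ge_atTop {i}] with s hs
    exact (s.piecewise_eq_of_mem x a (Finset.singleton_subset_iff.1 hs)).symm
  have hzero : ∀ s : Finset Λ, f (s.piecewise x a) = 0 := fun s =>
    AlmostDense.eq_zero_of_forall_notMem_finset hA hf h0 s _ fun α hα => by
      simpa [hα] using ha α
  exact tendsto_nhds_unique ((hf.tendsto x).comp hlim)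
    (tendsto_const_nhds.congr fun s => (hzero s).symm)
end

section
/- Let X₁, …, Xₙ be finitely many almost separable topological spaces. Then the product space ∏ᵢ Xᵢ is almost separable. -/
/-- A topological space is almost separable if it has a countable almost dense subset. -/
def AlmostSeparable (X : Type*) [TopologicalSpace X] : Prop :=
  ∃ A : Set X, A.Countable ∧ AlmostDense A

/-- A finite product of almost dense sets is almost dense. -/
theorem AlmostDense.univ_pi {ι : Type*} [Finite ι] {X : ι → Type*}
    [∀ i, TopologicalSpace (X i)] {A : ∀ i, Set (X i)} (hA : ∀ i, AlmostDense (A i)) :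
    AlmostDense (Set.univ.pi A) := by
  classical
  cases nonempty_fintype ι
  intro f hf hfA
  have key : ∀ s : Finset ι, ∀ x : ∀ i, X i, (∀ i ∉ s, x i ∈ A i) → f x = 0 := by
    intro s
    induction s using Finset.induction_on with
    | empty => exact fun x hx => hfA x fun i _ => hx i (Finset.notMem_empty i)
    | insert i s _ ih =>
      intro x hx
      have hu := hA i (fun y => f (Function.update x i y))
        (hf.comp (continuous_const.update i continuous_id)) (fun a ha => ih _ fun j hj => by
          obtain rfl | hji := eq_or_ne j i
          · simpa using ha
          · simpa [hji] using hx j (by simp [hji, hj])) (x i)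
      simpa using hu
  exact fun x => key Finset.univ x fun i hi => absurd (Finset.mem_univ i) hi

theorem almostSeparable_pi_finite {ι : Type*} [Finite ι] (X : ι → Type*)
    [∀ i, TopologicalSpace (X i)] (h : ∀ i, AlmostSeparable (X i)) :
    AlmostSeparable (∀ i, X i) := by
  choose A hAc hA using h
  exact ⟨Set.univ.pi A, Set.countable_univ_pi hAc, AlmostDense.univ_pi hA⟩
end

section
/- Let {X_α : α ∈ Λ} be a family of topological spaces, each functionally Hausdorff and containing at least two points, and suppose the product space X = ∏_{α∈Λ} X_α is almost separable. Then each X_α is almost separable and the cardinality of Λ is at most 𝔠 = 2^{ℵ₀}. -/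
/-- A topological space is functionally Hausdorff if distinct points can be
separated by a continuous real-valued function. -/
def FunctionallyHausdorff (X : Type*) [TopologicalSpace X] : Prop :=
  ∀ a b : X, a ≠ b → ∃ f : X → ℝ, Continuous f ∧ f a = 0 ∧ f b = 1

/-- The image of an almost dense set under a continuous surjection is almost dense. -/
theorem AlmostDense.image {X Y : Type*} [TopologicalSpace X] [TopologicalSpace Y]
    {A : Set X} (hA : AlmostDense A) {p : X → Y} (hp : Continuous p)
    (hsurj : Function.Surjective p) : AlmostDense (p '' A) := by
  intro f hf hzero y
  obtain ⟨x, rfl⟩ := hsurj y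
  exact hA (f ∘ p) (hf.comp hp) (fun a ha => hzero _ ⟨a, ha, rfl⟩) x

/-- Continuous real-valued functions that agree on an almost dense set are equal. -/
theorem AlmostDense.eq_of_eqOn {X : Type*} [TopologicalSpace X] {A : Set X}
    (hA : AlmostDense A) {f g : X → ℝ} (hf : Continuous f) (hg : Continuous g)
    (h : Set.EqOn f g A) : f = g :=
  funext fun x => sub_eq_zero.mp <|
    hA (fun x => f x - g x) (hf.sub hg) (fun _ ha => sub_eq_zero.mpr (h ha)) x

theorem almostSeparable_pi_factors {Λ : Type*} (X : Λ → Type*)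
    [∀ α, TopologicalSpace (X α)]
    (hfH : ∀ α, FunctionallyHausdorff (X α))
    (htwo : ∀ α, ∃ a b : X α, a ≠ b)
    (h : AlmostSeparable (∀ α, X α)) :
    (∀ α, AlmostSeparable (X α)) ∧ Cardinal.mk Λ ≤ Cardinal.continuum := by
  classical
  obtain ⟨A, hAc, hA⟩ := h
  choose a b hab using htwo
  have : ∀ α, Nonempty (X α) := fun α => ⟨a α⟩
  refine ⟨fun α => ⟨Function.eval α '' A, hAc.image _,
    hA.image (continuous_apply α) (Function.surjective_eval α)⟩, ?_⟩
  obtain ⟨x, hx⟩ := Set.countable_iff_exists_subset_range.mp hAc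
  choose f hf hfa hfb using fun α => hfH α (a α) (b α) (hab α)
  have hinj : Function.Injective fun (α : Λ) (n : ℕ) => f α (x n α) := by
    intro α β hαβ
    by_contra hne
    have heq : (fun z : ∀ γ, X γ => f α (z α)) = fun z => f β (z β) := by
      refine hA.eq_of_eqOn ((hf α).comp (continuous_apply α))
        ((hf β).comp (continuous_apply β)) fun z hz => ?_
      obtain ⟨n, rfl⟩ := hx hz
      exact congrFun hαβ n
    have hval := congrFun heq (Function.update a β (b β))
    simp [Function.update_of_ne hne, hfa, hfb] at hval
  have hcard := Cardinal.lift_mk_le_lift_mk_of_injective hinj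
  simpa [Cardinal.mk_real] using hcard
end

section
/- Let X be an almost separable topological space. Then the cardinality of C(X), the set of all continuous real-valued functions on X, is at most 𝔠 = 2^{ℵ₀}. -/
/-- Continuous real-valued functions agreeing on an almost dense set are equal. -/
theorem AlmostDense.restrict_injective {X : Type*} [TopologicalSpace X] {A : Set X}
    (hA : AlmostDense A) :
    Function.Injective fun (f : C(X, ℝ)) (a : A) => f a := by
  intro f g hfg
  ext x
  refine sub_eq_zero.mp (hA (fun y => f y - g y) (by fun_prop) (fun a ha => ?_) x)
  exact sub_eq_zero.mpr (congrFun hfg ⟨a, ha⟩)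

theorem card_continuousFunctions_le_continuum {X : Type*} [TopologicalSpace X]
    (h : AlmostSeparable X) : Cardinal.mk C(X, ℝ) ≤ Cardinal.continuum := by
  obtain ⟨A, hA, hdense⟩ := h
  calc
    Cardinal.mk C(X, ℝ) ≤ Cardinal.mk (A → ℝ) :=
      Cardinal.mk_le_of_injective hdense.restrict_injective
    _ = Cardinal.continuum ^ Cardinal.mk A := by simp [Cardinal.mk_real]
    _ ≤ Cardinal.continuum ^ Cardinal.aleph0 :=
      Cardinal.power_le_power_left Cardinal.continuum_ne_zero hA.le_aleph0
    _ = Cardinal.continuum := Cardinal.continuum_power_aleph0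
end

section
/- Let X be a topological space and let Y be an almost dense subset of X such that Y, with the subspace topology, is almost separable. Then X is almost separable. -/
theorem almostSeparable_of_almostDense_almostSeparable_subspace
    {X : Type*} [TopologicalSpace X] (Y : Set X)
    (hY : AlmostDense Y) (hsep : AlmostSeparable Y) : AlmostSeparable X := by
  obtain ⟨A, hA, hAd⟩ := hsep
  refine ⟨Subtype.val '' A, hA.image _, fun f hf h => hY f hf fun y hy => ?_⟩
  exact hAd (fun z => f z) (hf.comp continuous_subtype_val)
    (fun a ha => h a ⟨a, ha, rfl⟩) ⟨y, hy⟩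
end
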